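/- arXiv:1602.01972 — 2 statements merged into one kernel-verified Lean document; each statement's English description precedes it below -/
import Mathlib

section
/- Let A = U − V be a proper weak regular splitting of a real m×n matrix A. If A†U ≥ 0, then ρ(U†V) = (ρ(A†U) − 1)/ρ(A†U); in particular ρ(U†V) < 1. -/
open Matrix

/-- `G` is the Moore-Penrose inverse of `A` (the four Penrose equations). -/
def IsMoorePenrose {m n : ℕ} (A : Matrix (Fin m) (Fin n) ℝ)
    (G : Matrix (Fin n) (Fin m) ℝ) : Prop :=
  A * G * A = A ∧ G * A * G = G ∧ (A * G)ᵀ = A * G ∧ (G * A)ᵀ = G * A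

/-- `A = U - V` is a proper splitting: `range U = range A` and `null U = null A`. -/
def IsProperSplitting {m n : ℕ} (A U V : Matrix (Fin m) (Fin n) ℝ) : Prop :=
  A = U - V ∧
    LinearMap.range U.mulVecLin = LinearMap.range A.mulVecLin ∧
    LinearMap.ker U.mulVecLin = LinearMap.ker A.mulVecLin

/-- The spectral radius of a real square matrix: the maximum modulus of its
complex eigenvalues. -/
noncomputable def specRad {k : ℕ} (X : Matrix (Fin k) (Fin k) ℝ) : ℝ :=
  (spectralRadius ℂ (X.map Complex.ofReal)).toReal

open Filter Topology

section SpectralRadius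

attribute [local instance] Matrix.linftyOpNormedRing Matrix.linftyOpNormedAlgebra

variable {k : ℕ}

theorem norm_entry_le_linfty_opNorm (M : Matrix (Fin k) (Fin k) ℂ) (i j : Fin k) :
    ‖M i j‖ ≤ ‖M‖ := by
  have h : ‖M i j‖₊ ≤ ‖M‖₊ := by
    rw [Matrix.linfty_opNNNorm_def]
    exact (Finset.single_le_sum (f := fun j => ‖M i j‖₊) (fun _ _ => zero_le)
      (Finset.mem_univ j)).trans
      (Finset.le_sup (f := fun i => ∑ j, ‖M i j‖₊) (Finset.mem_univ i))
  exact h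

theorem spectralRadius_ne_top (M : Matrix (Fin k) (Fin k) ℂ) : spectralRadius ℂ M ≠ ⊤ := by
  rcases Nat.eq_zero_or_pos k with rfl | hk
  · rw [Subsingleton.elim M 0, spectrum.spectralRadius_zero]
    simp
  · have : Nonempty (Fin k) := ⟨⟨0, hk⟩⟩
    have : CompleteSpace (Matrix (Fin k) (Fin k) ℂ) := FiniteDimensional.complete ℂ _
    obtain ⟨z, -, hz⟩ := spectrum.exists_nnnorm_eq_spectralRadius M
    rw [← hz]
    exact ENNReal.coe_ne_top

theorem norm_le_specRad {X : Matrix (Fin k) (Fin k) ℝ} {z : ℂ}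
    (hz : z ∈ spectrum ℂ (X.map Complex.ofReal)) : ‖z‖ ≤ specRad X := by
  have h : (‖z‖₊ : ENNReal) ≤ spectralRadius ℂ (X.map Complex.ofReal) :=
    le_iSup₂ (f := fun z (_ : z ∈ spectrum ℂ (X.map Complex.ofReal)) => (‖z‖₊ : ENNReal)) z hz
  simpa [specRad] using ENNReal.toReal_mono (spectralRadius_ne_top _) h

theorem exists_mem_spectrum_norm_eq_specRad [Nonempty (Fin k)] (X : Matrix (Fin k) (Fin k) ℝ) :
    ∃ z ∈ spectrum ℂ (X.map Complex.ofReal), ‖z‖ = specRad X := by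
  have : CompleteSpace (Matrix (Fin k) (Fin k) ℂ) := FiniteDimensional.complete ℂ _
  obtain ⟨z, hz, h⟩ := spectrum.exists_nnnorm_eq_spectralRadius (X.map Complex.ofReal)
  refine ⟨z, hz, ?_⟩
  simp [specRad, ← h]

theorem specRad_nonneg (X : Matrix (Fin k) (Fin k) ℝ) : 0 ≤ specRad X := ENNReal.toReal_nonneg

theorem specRad_zero : specRad (0 : Matrix (Fin k) (Fin k) ℝ) = 0 := by
  have h : (0 : Matrix (Fin k) (Fin k) ℝ).map Complex.ofReal = 0 := by ext; simp
  rw [specRad, h, spectrum.spectralRadius_zero, ENNReal.toReal_zero]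

theorem map_ofReal_pow (X : Matrix (Fin k) (Fin k) ℝ) (N : ℕ) :
    (X ^ N).map Complex.ofReal = X.map Complex.ofReal ^ N :=
  map_pow (Complex.ofRealHom.mapMatrix (m := Fin k)) X N

theorem tendsto_pow_entry_div_pow {X : Matrix (Fin k) (Fin k) ℝ} {t : ℝ} (ht : specRad X < t)
    (i j : Fin k) : Tendsto (fun N : ℕ => (X ^ N) i j / t ^ N) atTop (𝓝 0) := by
  have : CompleteSpace (Matrix (Fin k) (Fin k) ℂ) := FiniteDimensional.complete ℂ _
  obtain ⟨q, hq, hqt⟩ := exists_between ht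
  have hq0 : 0 < q := (specRad_nonneg X).trans_lt hq
  have ht0 : 0 < t := hq0.trans hqt
  have hlim := spectrum.pow_norm_pow_one_div_tendsto_nhds_spectralRadius (X.map Complex.ofReal)
  have hlt : spectralRadius ℂ (X.map Complex.ofReal) < ENNReal.ofReal q := by
    rw [← ENNReal.ofReal_toReal (spectralRadius_ne_top (X.map Complex.ofReal))]
    exact (ENNReal.ofReal_lt_ofReal_iff hq0).2 hq
  have hev := hlim.eventually_lt_const hlt
  refine squeeze_zero_norm' (a := fun N : ℕ => (q / t) ^ N) ?_
    (tendsto_pow_atTop_nhds_zero_of_lt_one (by positivity) ((div_lt_one ht0).2 hqt))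
  filter_upwards [hev, eventually_gt_atTop 0] with N hN hN0
  rw [ENNReal.ofReal_lt_ofReal_iff hq0] at hN
  have hpow : ‖X.map Complex.ofReal ^ N‖ ≤ q ^ N := by
    have h := pow_le_pow_left₀ (by positivity) hN.le N
    rwa [one_div, Real.rpow_inv_natCast_pow (norm_nonneg _) hN0.ne'] at h
  have hentry : ‖(X ^ N) i j‖ ≤ q ^ N := by
    refine le_trans ?_ hpow
    have h := norm_entry_le_linfty_opNorm (X.map Complex.ofReal ^ N) i j
    rw [← map_ofReal_pow] at h ⊢
    simpa using h
  rw [norm_div, norm_pow, Real.norm_of_nonneg ht0.le, div_pow]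
  gcongr

end SpectralRadius

theorem Matrix.mem_spectrum_iff_exists_mulVec {k : ℕ} {K : Type*} [Field K]
    {M : Matrix (Fin k) (Fin k) K} {z : K} :
    z ∈ spectrum K M ↔ ∃ v ≠ 0, M *ᵥ v = z • v := by
  rw [← Matrix.spectrum_toLin', ← Module.End.hasEigenvalue_iff_mem_spectrum]
  constructor
  · intro h
    obtain ⟨v, hv⟩ := h.exists_hasEigenvector
    exact ⟨v, hv.2, by simpa using hv.apply_eq_smul⟩
  · rintro ⟨v, hv, h⟩
    exact Module.End.hasEigenvalue_of_hasEigenvector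
      ⟨Module.End.mem_eigenspace_iff.2 (by simpa using h), hv⟩

section Perron

variable {k : ℕ}

theorem det_smul_one_sub_ne_zero {X : Matrix (Fin k) (Fin k) ℝ} {t : ℝ}
    (ht : (t : ℂ) ∉ spectrum ℂ (X.map Complex.ofReal)) : (t • 1 - X).det ≠ 0 := by
  contrapose! ht
  obtain ⟨v, hv, h⟩ := Matrix.exists_mulVec_eq_zero_iff.2 ht
  refine Matrix.mem_spectrum_iff_exists_mulVec.2 ⟨fun i => (v i : ℂ), ?_, ?_⟩
  · contrapose! hv
    ext i
    simpa using congrFun hv i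
  · ext i
    have hXv : X *ᵥ v = t • v := by
      rw [Matrix.sub_mulVec, Matrix.smul_mulVec, Matrix.one_mulVec, sub_eq_zero] at h
      exact h.symm
    have h2 := RingHom.map_mulVec Complex.ofRealHom X v i
    rw [hXv] at h2
    simp only [Pi.smul_apply, smul_eq_mul, map_mul] at h2
    exact h2.symm

theorem Matrix.pow_entry_nonneg {X : Matrix (Fin k) (Fin k) ℝ} (hX : ∀ i j, 0 ≤ X i j) (N : ℕ) :
    ∀ i j, 0 ≤ (X ^ N) i j := by
  induction N with
  | zero =>
    intro i j
    rw [pow_zero, Matrix.one_apply]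
    split_ifs <;> norm_num
  | succ N ih =>
    intro i j
    rw [pow_succ, Matrix.mul_apply]
    exact Finset.sum_nonneg fun l _ => mul_nonneg (ih i l) (hX l j)

theorem inv_smul_one_sub_entry_nonneg {X : Matrix (Fin k) (Fin k) ℝ} (hX : ∀ i j, 0 ≤ X i j)
    {t : ℝ} (ht : specRad X < t) (i j : Fin k) : 0 ≤ (t • 1 - X)⁻¹ i j := by
  have ht0 : 0 < t := (specRad_nonneg X).trans_lt ht
  have hdet : (t • 1 - X).det ≠ 0 := by
    refine det_smul_one_sub_ne_zero fun h => ht.not_ge ?_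
    simpa [abs_of_pos ht0] using norm_le_specRad h
  let S : ℕ → Matrix (Fin k) (Fin k) ℝ := fun N => ∑ l ∈ Finset.range N, (t⁻¹) ^ (l + 1) • X ^ l
  have hS0 : ∀ N i j, 0 ≤ S N i j := by
    intro N i j
    simp only [S, Matrix.sum_apply, Matrix.smul_apply, smul_eq_mul]
    exact Finset.sum_nonneg fun l _ => mul_nonneg (by positivity) (Matrix.pow_entry_nonneg hX l i j)
  have hS : ∀ N, (t • 1 - X) * S N = 1 - (t⁻¹) ^ N • X ^ N := by
    intro N
    induction N with
    | zero => simp [S]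
    | succ N ih =>
      have hsucc : S (N + 1) = S N + (t⁻¹) ^ (N + 1) • X ^ N := Finset.sum_range_succ _ _
      have hscal : t * t⁻¹ ^ (N + 1) = t⁻¹ ^ N := by
        rw [pow_succ', mul_inv_cancel_left₀ ht0.ne']
      rw [hsucc, mul_add, ih, sub_mul, smul_mul_assoc, one_mul, smul_smul, mul_smul_comm,
        ← pow_succ', hscal]
      abel
  have hSN : ∀ N, S N i j =
      (t • 1 - X)⁻¹ i j - ∑ l, (t • 1 - X)⁻¹ i l * ((X ^ N) l j / t ^ N) := by
    intro N
    have h : S N = (t • 1 - X)⁻¹ * (1 - (t⁻¹) ^ N • X ^ N) := by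
      rw [← hS, Matrix.nonsing_inv_mul_cancel_left _ _ hdet.isUnit]
    rw [h, mul_sub, mul_one, Matrix.sub_apply, Matrix.mul_apply]
    congr 1
    refine Finset.sum_congr rfl fun l _ => ?_
    rw [Matrix.smul_apply, smul_eq_mul, inv_pow]
    ring
  have hlim : Tendsto (fun N => S N i j) atTop (𝓝 ((t • 1 - X)⁻¹ i j)) := by
    have h : Tendsto (fun N => ∑ l, (t • 1 - X)⁻¹ i l * ((X ^ N) l j / t ^ N)) atTop
        (𝓝 (∑ l, (t • 1 - X)⁻¹ i l * 0)) :=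
      tendsto_finsetSum _ fun l _ => (tendsto_pow_entry_div_pow ht l j).const_mul _
    simp_rw [hSN]
    simpa using h.const_sub ((t • 1 - X)⁻¹ i j)
  exact ge_of_tendsto' hlim fun N => hS0 N i j

/-- Perron–Frobenius: the spectral radius of an entrywise nonnegative matrix is an eigenvalue. -/
theorem specRad_mem_spectrum [Nonempty (Fin k)] {X : Matrix (Fin k) (Fin k) ℝ}
    (hX : ∀ i j, 0 ≤ X i j) : (specRad X : ℂ) ∈ spectrum ℂ (X.map Complex.ofReal) := by
  by_contra hr
  have hdet := det_smul_one_sub_ne_zero hr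
  obtain ⟨z, hz, hzr⟩ := exists_mem_spectrum_norm_eq_specRad X
  obtain ⟨v, hv, hXv⟩ := Matrix.mem_spectrum_iff_exists_mulVec.1 hz
  set r := specRad X
  let w : Fin k → ℝ := fun i => ‖v i‖
  have hXw : ∀ i, r * w i ≤ (X *ᵥ w) i := by
    intro i
    have h := congrFun hXv i
    calc r * w i = ‖(z • v) i‖ := by simp [w, hzr]
      _ = ‖∑ j, (X i j : ℂ) * v j‖ := by rw [← h]; rfl
      _ ≤ ∑ j, ‖(X i j : ℂ) * v j‖ := norm_sum_le _ _
      _ = (X *ᵥ w) i := by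
        refine Finset.sum_congr rfl fun j _ => ?_
        simp [w, abs_of_nonneg (hX i j)]
  have hbound : ∀ t, r < t → ∀ i, w i ≤ (t - r) * ((t • 1 - X)⁻¹ *ᵥ w) i := by
    intro t ht i
    have hdet : (t • 1 - X).det ≠ 0 := by
      refine det_smul_one_sub_ne_zero fun h => ht.not_ge ?_
      simpa [abs_of_pos ((specRad_nonneg X).trans_lt ht)] using norm_le_specRad h
    have hw : w = (t • 1 - X)⁻¹ *ᵥ ((t • 1 - X) *ᵥ w) := by
      rw [Matrix.mulVec_mulVec, Matrix.nonsing_inv_mul _ hdet.isUnit, Matrix.one_mulVec]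
    calc w i = ((t • 1 - X)⁻¹ *ᵥ ((t • 1 - X) *ᵥ w)) i := congrFun hw i
      _ ≤ ((t • 1 - X)⁻¹ *ᵥ ((t - r) • w)) i := by
        change ∑ j, (t • 1 - X)⁻¹ i j * ((t • 1 - X) *ᵥ w) j ≤
          ∑ j, (t • 1 - X)⁻¹ i j * ((t - r) • w) j
        refine Finset.sum_le_sum fun j _ => mul_le_mul_of_nonneg_left ?_
          (inv_smul_one_sub_entry_nonneg hX ht i j)
        rw [Matrix.sub_mulVec, Matrix.smul_mulVec, Matrix.one_mulVec]
        simp only [Pi.sub_apply, Pi.smul_apply, smul_eq_mul]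
        linarith [hXw j]
      _ = _ := by rw [Matrix.mulVec_smul]; rfl
  have hcont : ∀ i, ContinuousAt (fun t : ℝ => (t - r) * ((t • 1 - X)⁻¹ *ᵥ w) i) r := by
    intro i
    have hM : Continuous fun t : ℝ => t • (1 : Matrix (Fin k) (Fin k) ℝ) - X := by fun_prop
    have hinv : ContinuousAt (fun t : ℝ => (t • 1 - X)⁻¹) r := by
      simp_rw [Matrix.inv_def, Ring.inverse_eq_inv']
      exact (hM.matrix_det.continuousAt.inv₀ hdet).smul hM.matrix_adjugate.continuousAt
    have hmv : ContinuousAt (fun t : ℝ => ((t • 1 - X)⁻¹ *ᵥ w) i) r := by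
      have h : Continuous fun M : Matrix (Fin k) (Fin k) ℝ => (M *ᵥ w) i :=
        (continuous_apply i).comp (continuous_id.matrix_mulVec continuous_const)
      exact ContinuousAt.comp (g := fun M : Matrix (Fin k) (Fin k) ℝ => (M *ᵥ w) i)
        h.continuousAt hinv
    exact (continuousAt_id.sub continuousAt_const).mul hmv
  apply hv
  ext i
  have hle : w i ≤ (r - r) * ((r • 1 - X)⁻¹ *ᵥ w) i := by
    refine ge_of_tendsto ((hcont i).tendsto.mono_left nhdsWithin_le_nhds : Tendsto _ (𝓝[>] r) _) ?_
    filter_upwards [self_mem_nhdsWithin] with t ht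
    exact hbound t ht i
  rw [sub_self, zero_mul] at hle
  exact norm_le_zero_iff.1 hle

end Perron

section Corner

variable {k : ℕ} {P X Y : Matrix (Fin k) (Fin k) ℝ}

theorem specRad_lt_one_of_corner_inverse (hX : ∀ i j, 0 ≤ X i j) (hY : ∀ i j, 0 ≤ Y i j)
    (hXP : X * P = X) (hinv : (P - X) * Y = P) (hPY : P * Y = Y) [Nonempty (Fin k)] :
    specRad X < 1 := by
  have hYe : Y = P + X * Y := by
    rw [sub_mul, hPY] at hinv
    rw [← hinv, sub_add_cancel]
  have htel : ∀ N, X ^ (N + 1) = X ^ (N + 1) * Y - X ^ (N + 2) * Y := by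
    intro N
    have h : X ^ (N + 1) * Y = X ^ (N + 1) + X ^ (N + 2) * Y := by
      conv_lhs => rw [hYe]
      rw [mul_add, ← mul_assoc, ← pow_succ, pow_succ X N, mul_assoc _ X P, hXP]
    rw [h, add_sub_cancel_right]
  have hsum : ∀ N, ∑ l ∈ Finset.range N, X ^ (l + 1) = X * Y - X ^ (N + 1) * Y := by
    intro N
    rw [Finset.sum_congr rfl fun l _ => htel l,
      Finset.sum_range_sub' (fun l => X ^ (l + 1) * Y) N]
    simp
  have hlim : ∀ i j, Tendsto (fun N : ℕ => (X ^ (N + 1)) i j) atTop (𝓝 0) := by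
    intro i j
    refine (summable_of_sum_range_le (c := (X * Y) i j)
      (fun N => Matrix.pow_entry_nonneg hX (N + 1) i j) fun N => ?_).tendsto_atTop_zero
    have h := congrFun (congrFun (hsum N) i) j
    rw [Matrix.sum_apply, Matrix.sub_apply] at h
    rw [h, sub_le_self_iff, Matrix.mul_apply]
    exact Finset.sum_nonneg fun l _ =>
      mul_nonneg (Matrix.pow_entry_nonneg hX (N + 1) i l) (hY l j)
  obtain ⟨z, hz, hzr⟩ := exists_mem_spectrum_norm_eq_specRad X
  obtain ⟨v, hv, hXv⟩ := Matrix.mem_spectrum_iff_exists_mulVec.1 hz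
  have hpow : ∀ N, (X.map Complex.ofReal ^ N) *ᵥ v = z ^ N • v := by
    intro N
    induction N with
    | zero => simp
    | succ N ih =>
      rw [pow_succ, ← Matrix.mulVec_mulVec, hXv, Matrix.mulVec_smul, ih, smul_smul, pow_succ']
  obtain ⟨i, hi⟩ := Function.ne_iff.1 hv
  have hzv : Tendsto (fun N : ℕ => z ^ (N + 1) * v i) atTop (𝓝 0) := by
    have h : Tendsto (fun N : ℕ => ∑ j, ((X ^ (N + 1)) i j : ℂ) * v j) atTop
        (𝓝 (∑ j, ((0 : ℝ) : ℂ) * v j)) :=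
      tendsto_finsetSum _ fun j _ =>
        ((Complex.continuous_ofReal.tendsto 0).comp (hlim i j)).mul_const _
    simp only [Complex.ofReal_zero, zero_mul, Finset.sum_const_zero] at h
    refine h.congr fun N => ?_
    have h2 := congrFun (hpow (N + 1)) i
    rw [← map_ofReal_pow] at h2
    exact h2
  have hz0 : Tendsto (fun N : ℕ => z ^ (N + 1)) atTop (𝓝 0) := by
    have h := hzv.mul_const (v i)⁻¹
    simpa [mul_assoc, mul_inv_cancel₀ hi] using h
  rw [← hzr]
  exact tendsto_pow_atTop_nhds_zero_iff_norm_lt_one.1 ((tendsto_add_atTop_iff_nat 1).1 hz0)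

theorem one_le_specRad_of_corner_inverse (hX : ∀ i j, 0 ≤ X i j) (hY : ∀ i j, 0 ≤ Y i j)
    (hPP : P * P = P) (hPt : Pᵀ = P) (hP : P ≠ 0)
    (hinv : (P - X) * Y = P) (hYP : Y * P = Y) (hPY : P * Y = Y) :
    1 ≤ specRad Y := by
  have hYe : Y = P + X * Y := by
    rw [sub_mul, hPY] at hinv
    rw [← hinv, sub_add_cancel]
  have hXY : ∀ i j, 0 ≤ (X * Y) i j := fun i j => by
    rw [Matrix.mul_apply]
    exact Finset.sum_nonneg fun l _ => mul_nonneg (hX i l) (hY l j)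
  have hge : ∀ N i j, P i j ≤ (Y ^ (N + 1)) i j := by
    intro N
    induction N with
    | zero =>
      intro i j
      have h := congrFun (congrFun hYe i) j
      rw [Matrix.add_apply] at h
      rw [zero_add, pow_one]
      linarith [hXY i j]
    | succ N ih =>
      intro i j
      have h : Y ^ (N + 2) = Y ^ (N + 1) + Y ^ (N + 1) * (X * Y) := by
        rw [pow_succ Y (N + 1)]
        conv_lhs => enter [2]; rw [hYe]
        rw [mul_add, pow_succ Y N, mul_assoc _ Y P, hYP]
      rw [h, Matrix.add_apply]
      have h2 : 0 ≤ (Y ^ (N + 1) * (X * Y)) i j := by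
        rw [Matrix.mul_apply]
        exact Finset.sum_nonneg fun l _ =>
          mul_nonneg (Matrix.pow_entry_nonneg hY (N + 1) i l) (hXY l j)
      linarith [ih i j]
  by_contra! hlt
  apply hP
  have hdiag : ∀ i, P i i ≤ 0 := by
    intro i
    have h := (tendsto_add_atTop_iff_nat 1).2 (tendsto_pow_entry_div_pow hlt i i)
    simp only [one_pow, div_one] at h
    exact ge_of_tendsto' h fun N => hge N i i
  ext i j
  have h : P i i = ∑ l, P i l * P i l := by
    conv_lhs => rw [← hPP, Matrix.mul_apply]
    refine Finset.sum_congr rfl fun l _ => ?_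
    congr 1
    exact congrFun (congrFun hPt i) l
  have h2 : P i j * P i j ≤ ∑ l, P i l * P i l :=
    Finset.single_le_sum (f := fun l => P i l * P i l) (fun l _ => mul_self_nonneg _)
      (Finset.mem_univ j)
  exact mul_self_eq_zero.1 (le_antisymm (by linarith [hdiag i]) (mul_self_nonneg _))

theorem map_ofReal_mulVec_eq_of_mul_eq {B C D : Matrix (Fin k) (Fin k) ℝ} (h : B * C = D)
    (v : Fin k → ℂ) : B.map Complex.ofReal *ᵥ (C.map Complex.ofReal *ᵥ v) =
      D.map Complex.ofReal *ᵥ v := by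
  rw [Matrix.mulVec_mulVec, ← h]
  congr 1
  exact (map_mul (Complex.ofRealHom.mapMatrix (m := Fin k)) B C).symm

theorem one_sub_inv_mem_spectrum (hinv : (P - X) * Y = P) (hPY : P * Y = Y) {z : ℂ} (hz0 : z ≠ 0)
    (hz : z ∈ spectrum ℂ (Y.map Complex.ofReal)) :
    1 - z⁻¹ ∈ spectrum ℂ (X.map Complex.ofReal) := by
  obtain ⟨v, hv, hYv⟩ := Matrix.mem_spectrum_iff_exists_mulVec.1 hz
  refine Matrix.mem_spectrum_iff_exists_mulVec.2 ⟨v, hv, ?_⟩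
  have hPv : P.map Complex.ofReal *ᵥ v = v := by
    have h := map_ofReal_mulVec_eq_of_mul_eq hPY v
    rw [hYv, Matrix.mulVec_smul] at h
    exact smul_right_injective _ hz0 h
  have hXY : X * Y = Y - P := by
    rw [sub_mul, hPY] at hinv
    rw [← hinv, sub_sub_cancel]
  have h := map_ofReal_mulVec_eq_of_mul_eq hXY v
  rw [Matrix.map_sub _ Complex.ofReal_sub, Matrix.sub_mulVec, hYv, hPv, Matrix.mulVec_smul] at h
  apply smul_right_injective _ hz0
  change z • _ = z • _
  rw [h, smul_smul, mul_sub, mul_inv_cancel₀ hz0, mul_one, sub_smul, one_smul]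

theorem inv_one_sub_mem_spectrum (hinv : Y * (P - X) = P) (hYP : Y * P = Y) (hPX : P * X = X)
    {z : ℂ} (hz0 : z ≠ 0) (hz1 : 1 - z ≠ 0) (hz : z ∈ spectrum ℂ (X.map Complex.ofReal)) :
    (1 - z)⁻¹ ∈ spectrum ℂ (Y.map Complex.ofReal) := by
  obtain ⟨v, hv, hXv⟩ := Matrix.mem_spectrum_iff_exists_mulVec.1 hz
  refine Matrix.mem_spectrum_iff_exists_mulVec.2 ⟨v, hv, ?_⟩
  have hPv : P.map Complex.ofReal *ᵥ v = v := by
    have h := map_ofReal_mulVec_eq_of_mul_eq hPX v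
    rw [hXv, Matrix.mulVec_smul] at h
    exact smul_right_injective _ hz0 h
  have hYX : Y * X = Y - P := by
    rw [mul_sub, hYP] at hinv
    rw [← hinv, sub_sub_cancel]
  have h := map_ofReal_mulVec_eq_of_mul_eq hYX v
  rw [Matrix.map_sub _ Complex.ofReal_sub, Matrix.sub_mulVec, hXv, hPv, Matrix.mulVec_smul] at h
  apply smul_right_injective _ hz1
  change (1 - z) • _ = (1 - z) • _
  rw [smul_smul, mul_inv_cancel₀ hz1, one_smul, sub_smul, one_smul, h, sub_sub_cancel]

theorem specRad_corner_inverse (hX : ∀ i j, 0 ≤ X i j) (hY : ∀ i j, 0 ≤ Y i j)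
    (hPP : P * P = P) (hPt : Pᵀ = P) (hP : P ≠ 0)
    (hXP : X * P = X) (hPX : P * X = X) (hYP : Y * P = Y) (hPY : P * Y = Y)
    (hinv : (P - X) * Y = P) (hinv' : Y * (P - X) = P) :
    specRad X < 1 ∧ specRad Y * (1 - specRad X) = 1 := by
  have : Nonempty (Fin k) := by
    by_contra h
    rw [not_nonempty_iff] at h
    exact hP (Subsingleton.elim _ _)
  have hr := specRad_lt_one_of_corner_inverse hX hY hXP hinv hPY
  have hs := one_le_specRad_of_corner_inverse hX hY hPP hPt hP hinv hYP hPY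
  refine ⟨hr, le_antisymm ?_ ?_⟩
  · obtain ⟨z, hz, hzs⟩ := exists_mem_spectrum_norm_eq_specRad Y
    have hs0 : 0 < specRad Y := by linarith
    have hz0 : z ≠ 0 := norm_pos_iff.1 (by rwa [hzs])
    have h1 := norm_le_specRad (one_sub_inv_mem_spectrum hinv hPY hz0 hz)
    have h2 : 1 - ‖z⁻¹‖ ≤ ‖1 - z⁻¹‖ := by simpa using norm_sub_norm_le 1 z⁻¹
    rw [norm_inv, hzs] at h2
    calc specRad Y * (1 - specRad X) ≤ specRad Y * (specRad Y)⁻¹ :=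
          mul_le_mul_of_nonneg_left (by linarith) hs0.le
      _ = 1 := mul_inv_cancel₀ hs0.ne'
  · rcases (specRad_nonneg X).eq_or_lt with h0 | h0
    · rwa [← h0, sub_zero, mul_one]
    · have h1 : 0 < 1 - specRad X := by linarith
      have hz0 : (specRad X : ℂ) ≠ 0 := by exact_mod_cast h0.ne'
      have hz1 : 1 - (specRad X : ℂ) ≠ 0 := by exact_mod_cast h1.ne'
      have h2 := norm_le_specRad
        (inv_one_sub_mem_spectrum hinv' hYP hPX hz0 hz1 (specRad_mem_spectrum hX))
      rw [norm_inv, ← Complex.ofReal_one, ← Complex.ofReal_sub, Complex.norm_real,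
        Real.norm_of_nonneg h1.le] at h2
      exact (inv_le_iff_one_le_mul₀ h1).1 h2

end Corner

section Splitting

variable {m n : ℕ} {A U : Matrix (Fin m) (Fin n) ℝ} {Ud : Matrix (Fin n) (Fin m) ℝ}

theorem mul_mul_eq_of_range_le (hU : U * Ud * U = U)
    (h : LinearMap.range A.mulVecLin ≤ LinearMap.range U.mulVecLin) : U * Ud * A = A := by
  apply Matrix.ext_of_mulVec_single
  intro i
  obtain ⟨y, hy⟩ := h ⟨Pi.single i 1, rfl⟩
  rw [Matrix.mulVecLin_apply, Matrix.mulVecLin_apply] at hy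
  rw [← Matrix.mulVec_mulVec, ← hy, Matrix.mulVec_mulVec, hU]

theorem mul_mul_eq_of_ker_le (hU : U * Ud * U = U)
    (h : LinearMap.ker U.mulVecLin ≤ LinearMap.ker A.mulVecLin) : A * (Ud * U) = A := by
  apply Matrix.ext_of_mulVec_single
  intro i
  have hx : (Pi.single i 1 - (Ud * U) *ᵥ Pi.single i 1 : Fin n → ℝ) ∈
      LinearMap.ker U.mulVecLin := by
    rw [LinearMap.mem_ker, Matrix.mulVecLin_apply, Matrix.mulVec_sub, Matrix.mulVec_mulVec,
      ← Matrix.mul_assoc, hU, sub_self]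
  have h2 := h hx
  rw [LinearMap.mem_ker, Matrix.mulVecLin_apply, Matrix.mulVec_sub, Matrix.mulVec_mulVec,
    sub_eq_zero] at h2
  exact h2.symm

end Splitting

theorem stmt7 {m n : ℕ} (A U V : Matrix (Fin m) (Fin n) ℝ)
    (Ad Ud : Matrix (Fin n) (Fin m) ℝ)
    (hA : IsMoorePenrose A Ad) (hU : IsMoorePenrose U Ud)
    (hPS : IsProperSplitting A U V)
    (hUd : ∀ i j, 0 ≤ Ud i j) (hUV : ∀ i j, 0 ≤ (Ud * V) i j)
    (hAU : ∀ i j, 0 ≤ (Ad * U) i j) :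
    specRad (Ud * V) = (specRad (Ad * U) - 1) / specRad (Ad * U) ∧
      specRad (Ud * V) < 1 := by
  obtain ⟨hA1, hA2, -, hA4⟩ := hA
  obtain ⟨hU1, hU2, -, hU4⟩ := hU
  obtain ⟨hAUV, hR, hK⟩ := hPS
  have hV : V = U - A := by rw [hAUV, sub_sub_cancel]
  have hUA : U * (Ud * A) = A := by rw [← Matrix.mul_assoc, mul_mul_eq_of_range_le hU1 hR.ge]
  have hAU' : A * (Ad * U) = U := by rw [← Matrix.mul_assoc, mul_mul_eq_of_range_le hA1 hR.le]
  have hAP : A * (Ud * U) = A := mul_mul_eq_of_ker_le hU1 hK.le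
  have hUP : U * (Ad * A) = U := mul_mul_eq_of_ker_le hA1 hK.ge
  have hproj : Ad * A = Ud * U := by
    have h := congrArg Matrix.transpose
      (show Ad * A * (Ud * U) = Ad * A by rw [Matrix.mul_assoc, hAP])
    rw [Matrix.transpose_mul, hA4, hU4, Matrix.mul_assoc, hUP] at h
    exact h.symm
  have hPP : Ud * U * (Ud * U) = Ud * U := by rw [← Matrix.mul_assoc, hU2]
  have hX : Ud * V = Ud * U - Ud * A := by rw [hV, Matrix.mul_sub]
  have hinv : (Ud * U - Ud * V) * (Ad * U) = Ud * U := by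
    rw [hX, sub_sub_cancel, Matrix.mul_assoc, hAU']
  have hinv' : Ad * U * (Ud * U - Ud * V) = Ud * U := by
    rw [hX, sub_sub_cancel, Matrix.mul_assoc, hUA, hproj]
  have hXP : Ud * V * (Ud * U) = Ud * V := by
    rw [hX, Matrix.sub_mul, hPP, Matrix.mul_assoc Ud A, hAP]
  have hPX : Ud * U * (Ud * V) = Ud * V := by rw [← Matrix.mul_assoc, hU2]
  have hYP : Ad * U * (Ud * U) = Ad * U := by
    rw [Matrix.mul_assoc, ← Matrix.mul_assoc U, hU1]
  have hPY : Ud * U * (Ad * U) = Ad * U := by rw [← hproj, ← Matrix.mul_assoc, hA2]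
  by_cases hP : Ud * U = 0
  · have hX0 : Ud * V = 0 := by rw [← hPX, hP, zero_mul]
    have hY0 : Ad * U = 0 := by rw [← hPY, hP, zero_mul]
    rw [hX0, hY0, specRad_zero]
    norm_num
  · obtain ⟨hlt, hmul⟩ :=
      specRad_corner_inverse hUV hAU hPP hU4 hP hXP hPX hYP hPY hinv hinv'
    refine ⟨?_, hlt⟩
    have hs : specRad (Ad * U) ≠ 0 := fun h => by simp [h] at hmul
    rw [eq_div_iff hs]
    linarith
end

section
/- Let A = U − V be a proper weak regular splitting of a real m×n matrix A. If ρ(U†V) < 1, then (I − U†V)⁻¹ ≥ 0 and A†V ≥ 0. -/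
open Matrix

open Filter Topology

theorem tendsto_pow_nhds_zero_of_spectralRadius_lt_one {A : Type*} [NormedRing A]
    [NormedAlgebra ℂ A] [CompleteSpace A] {a : A} (ha : spectralRadius ℂ a < 1) :
    Tendsto (fun k : ℕ => a ^ k) atTop (𝓝 0) := by
  obtain ⟨r, hr, hr1⟩ := exists_between ha
  lift r to NNReal using (hr1.trans ENNReal.one_lt_top).ne
  have hr1' : r < 1 := by exact_mod_cast hr1
  have hev := (spectrum.pow_nnnorm_pow_one_div_tendsto_nhds_spectralRadius a).eventually_lt_const hr
  refine squeeze_zero_norm' ?_ (tendsto_pow_atTop_nhds_zero_of_lt_one r.coe_nonneg hr1')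
  filter_upwards [hev, eventually_gt_atTop 0] with k hk hk0
  have hk0' : (0 : ℝ) < k := by exact_mod_cast hk0
  rw [one_div, ENNReal.rpow_inv_lt_iff hk0', ENNReal.rpow_natCast] at hk
  exact_mod_cast hk.le

theorem spectralRadius_ne_top_s8 {A : Type*} [NormedRing A] [NormedAlgebra ℂ A] [CompleteSpace A]
    (a : A) : spectralRadius ℂ a ≠ ⊤ := by
  have h := spectrum.spectralRadius_le_pow_nnnorm_pow_one_div ℂ a 0
  simp only [Nat.cast_zero, zero_add, div_one, ENNReal.rpow_one, ← ENNReal.coe_mul] at h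
  exact (h.trans_lt ENNReal.coe_lt_top).ne

section

attribute [local instance] Matrix.linftyOpNormedRing Matrix.linftyOpNormedAlgebra

theorem spectralRadius_lt_one_of_specRad_lt_one {k : ℕ} {X : Matrix (Fin k) (Fin k) ℝ}
    (hX : specRad X < 1) : spectralRadius ℂ (X.map Complex.ofReal) < 1 := by
  rw [specRad] at hX
  rwa [← ENNReal.toReal_one,
    ENNReal.toReal_lt_toReal (spectralRadius_ne_top_s8 _) ENNReal.one_ne_top] at hX

theorem tendsto_pow_apply_of_specRad_lt_one {k : ℕ} {X : Matrix (Fin k) (Fin k) ℝ}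
    (hX : specRad X < 1) (i j : Fin k) :
    Tendsto (fun p : ℕ => (X ^ p) i j) atTop (𝓝 0) := by
  have h := tendsto_pow_nhds_zero_of_spectralRadius_lt_one
    (spectralRadius_lt_one_of_specRad_lt_one hX)
  have hentry : Tendsto (fun p : ℕ => ((X.map Complex.ofReal) ^ p) i j) atTop (𝓝 0) :=
    ((continuous_id.matrix_elem i j).tendsto (0 : Matrix (Fin k) (Fin k) ℂ)).comp h
  have hre := (Complex.continuous_re.tendsto 0).comp hentry
  refine hre.congr fun p => ?_
  have hp : X.map Complex.ofReal ^ p = (X ^ p).map Complex.ofReal :=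
    (map_pow Complex.ofRealHom.mapMatrix X p).symm
  simp [hp]

end

theorem isUnit_one_sub_of_specRad_lt_one {k : ℕ} {X : Matrix (Fin k) (Fin k) ℝ}
    (hX : specRad X < 1) : IsUnit (1 - X) := by
  rw [← Matrix.mulVec_injective_iff_isUnit, ← Matrix.coe_mulVecLin, injective_iff_map_eq_zero]
  intro v hv
  have hfix : X *ᵥ v = v := by
    rw [Matrix.mulVecLin_apply, Matrix.sub_mulVec, Matrix.one_mulVec, sub_eq_zero] at hv
    exact hv.symm
  have hpow (p : ℕ) : (X ^ p) *ᵥ v = v := by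
    induction p with
    | zero => simp
    | succ p ih => rw [pow_succ, ← Matrix.mulVec_mulVec, hfix, ih]
  ext i
  have hlim : Tendsto (fun p : ℕ => ((X ^ p) *ᵥ v) i) atTop (𝓝 (∑ j, 0 * v j)) :=
    tendsto_finsetSum _ fun j _ => (tendsto_pow_apply_of_specRad_lt_one hX i j).mul_const _
  simp only [hpow, zero_mul, Finset.sum_const_zero] at hlim
  exact tendsto_nhds_unique tendsto_const_nhds hlim

/-- The resolvent of a nonnegative matrix with spectral radius less than one is the limit of the
nonnegative partial sums of its Neumann series. -/
theorem inv_one_sub_apply_nonneg_of_specRad_lt_one {k : ℕ} {X : Matrix (Fin k) (Fin k) ℝ}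
    (hnn : ∀ i j, 0 ≤ X i j) (hX : specRad X < 1) (i j : Fin k) :
    0 ≤ ((1 - X)⁻¹ : Matrix (Fin k) (Fin k) ℝ) i j := by
  have hdet := (Matrix.isUnit_iff_isUnit_det _).1 (isUnit_one_sub_of_specRad_lt_one hX)
  have hsum (p : ℕ) : (∑ t ∈ Finset.range p, X ^ t) i j =
      (1 - X)⁻¹ i j - ((1 - X)⁻¹ * X ^ p) i j := by
    have h : ∑ t ∈ Finset.range p, X ^ t = (1 - X)⁻¹ - (1 - X)⁻¹ * X ^ p := by
      rw [← mul_one_sub, ← mul_neg_geom_sum, Matrix.nonsing_inv_mul_cancel_left _ _ hdet]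
    rw [h, Matrix.sub_apply]
  have hlim : Tendsto (fun p : ℕ => ((1 - X)⁻¹ * X ^ p) i j) atTop
      (𝓝 (∑ t, (1 - X)⁻¹ i t * 0)) :=
    tendsto_finsetSum _ fun t _ => (tendsto_pow_apply_of_specRad_lt_one hX t j).const_mul _
  have hlim' := hlim.const_sub ((1 - X)⁻¹ i j)
  simp only [mul_zero, Finset.sum_const_zero, sub_zero, ← hsum] at hlim'
  refine ge_of_tendsto' hlim' fun p => ?_
  rw [Matrix.sum_apply]
  exact Finset.sum_nonneg fun t _ => Matrix.pow_apply_nonneg hnn t i j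

section MoorePenrose

variable {m n : ℕ} {A B : Matrix (Fin m) (Fin n) ℝ} {G H : Matrix (Fin n) (Fin m) ℝ}

theorem mul_mul_eq_of_range_le_s8 (hA : A * G * A = A)
    (h : LinearMap.range B.mulVecLin ≤ LinearMap.range A.mulVecLin) : A * G * B = B := by
  refine Matrix.ext_of_mulVec_single fun i => ?_
  obtain ⟨w, hw⟩ := h ⟨Pi.single i 1, rfl⟩
  simp only [Matrix.mulVecLin_apply] at hw
  rw [← Matrix.mulVec_mulVec, ← hw, Matrix.mulVec_mulVec, hA]

theorem mul_mul_eq_of_ker_le_s8 (hA : A * G * A = A)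
    (h : LinearMap.ker A.mulVecLin ≤ LinearMap.ker B.mulVecLin) : B * G * A = B := by
  refine Matrix.ext_of_mulVec_single fun i => ?_
  have hmem : Pi.single i 1 - (G * A) *ᵥ Pi.single i 1 ∈ LinearMap.ker A.mulVecLin := by
    rw [LinearMap.mem_ker, Matrix.mulVecLin_apply, Matrix.mulVec_sub, Matrix.mulVec_mulVec,
      ← Matrix.mul_assoc, hA, sub_self]
  have hB := h hmem
  rw [LinearMap.mem_ker, Matrix.mulVecLin_apply, Matrix.mulVec_sub, Matrix.mulVec_mulVec,
    ← Matrix.mul_assoc, sub_eq_zero] at hB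
  exact hB.symm

theorem IsMoorePenrose.mul_eq_mul_of_range_eq (hA : IsMoorePenrose A G) (hB : IsMoorePenrose B H)
    (h : LinearMap.range B.mulVecLin = LinearMap.range A.mulVecLin) : A * G = B * H := by
  have hAB : A * G * (B * H) = B * H := by
    rw [← Matrix.mul_assoc, mul_mul_eq_of_range_le_s8 hA.1 h.le]
  have hBA : B * H * (A * G) = A * G := by
    rw [← Matrix.mul_assoc, mul_mul_eq_of_range_le_s8 hB.1 h.ge]
  rw [← hA.2.2.1, ← hBA, Matrix.transpose_mul, hA.2.2.1, hB.2.2.1, hAB]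

theorem IsMoorePenrose.mul_eq_mul_of_ker_eq (hA : IsMoorePenrose A G) (hB : IsMoorePenrose B H)
    (h : LinearMap.ker B.mulVecLin = LinearMap.ker A.mulVecLin) : G * A = H * B := by
  have hAB : G * A * (H * B) = G * A := by
    rw [Matrix.mul_assoc G, ← Matrix.mul_assoc A, mul_mul_eq_of_ker_le_s8 hB.1 h.le]
  have hBA : H * B * (G * A) = H * B := by
    rw [Matrix.mul_assoc H, ← Matrix.mul_assoc B, mul_mul_eq_of_ker_le_s8 hA.1 h.ge]
  rw [← hA.2.2.2, ← hAB, Matrix.transpose_mul, hA.2.2.2, hB.2.2.2, hBA]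

end MoorePenrose

theorem IsProperSplitting.one_sub_mul_eq {m n : ℕ} {A U V : Matrix (Fin m) (Fin n) ℝ}
    {Ad Ud : Matrix (Fin n) (Fin m) ℝ} (hPS : IsProperSplitting A U V)
    (hA : IsMoorePenrose A Ad) (hU : IsMoorePenrose U Ud) :
    (1 - Ud * V) * Ad = Ud := by
  have hV : V = U - A := by rw [hPS.1, sub_sub_cancel]
  have hUU : Ud * U * Ad = Ad := by rw [← hA.mul_eq_mul_of_ker_eq hU hPS.2.2, hA.2.1]
  have hUA : Ud * A * Ad = Ud := by
    rw [Matrix.mul_assoc, hA.mul_eq_mul_of_range_eq hU hPS.2.1, ← Matrix.mul_assoc, hU.2.1]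
  rw [hV, Matrix.sub_mul, Matrix.mul_sub, Matrix.sub_mul, hUU, hUA, Matrix.one_mul, sub_sub_cancel]

theorem stmt8 {m n : ℕ} (A U V : Matrix (Fin m) (Fin n) ℝ)
    (Ad Ud : Matrix (Fin n) (Fin m) ℝ)
    (hA : IsMoorePenrose A Ad) (hU : IsMoorePenrose U Ud)
    (hPS : IsProperSplitting A U V)
    (hUd : ∀ i j, 0 ≤ Ud i j) (hUV : ∀ i j, 0 ≤ (Ud * V) i j)
    (hρ : specRad (Ud * V) < 1) :
    (∀ i j, 0 ≤ ((1 - Ud * V)⁻¹ : Matrix (Fin n) (Fin n) ℝ) i j) ∧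
      (∀ i j, 0 ≤ (Ad * V) i j) := by
  have hinv := inv_one_sub_apply_nonneg_of_specRad_lt_one hUV hρ
  refine ⟨hinv, ?_⟩
  have hdet := (Matrix.isUnit_iff_isUnit_det _).1 (isUnit_one_sub_of_specRad_lt_one hρ)
  have hAd : Ad = (1 - Ud * V)⁻¹ * Ud :=
    ((Matrix.nonsing_inv_mul_cancel_left _ _ hdet).symm).trans
      (congrArg _ (hPS.one_sub_mul_eq hA hU))
  have hAdV : Ad * V = (1 - Ud * V)⁻¹ * (Ud * V) := by
    rw [← Matrix.mul_assoc, ← hAd]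
  rw [hAdV]
  intro i j
  rw [Matrix.mul_apply]
  exact Finset.sum_nonneg fun t _ => mul_nonneg (hinv i t) (hUV t j)
end
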